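/- Let P₁, …, P_k (k ≥ 2) be polytopes, each with at least two vertices, in finite-dimensional real inner product spaces, and let P = P₁ × ⋯ × P_k carry the ℓ² product norm. Then δ(P) ≥ (1/√2)^{⌈log₂(k+1)⌉} · minᵢ δ(Pᵢ). -/

import Mathlib

section Defs

variable {E : Type*} [NormedAddCommGroup E] [InnerProductSpace ℝ E]

/-- The (Euclidean) distance between two sets. -/
noncomputable def setDist {X : Type*} [PseudoMetricSpace X] (A B : Set X) : ℝ :=
  sInf ((fun p : X × X => dist p.1 p.2) '' (A ×ˢ B))

/-- A polytope: the convex hull of a nonempty finite set of points. -/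
def IsPolytope (S : Set E) : Prop :=
  ∃ V : Set E, V.Finite ∧ V.Nonempty ∧ S = convexHull ℝ V

/-- A face of `P`: a nonempty proper exposed face. -/
def IsFaceOf (P f : Set E) : Prop :=
  IsExposed ℝ P f ∧ f.Nonempty ∧ f ≠ P

/-- `P^f = conv(V(P) \ V(f))`, where `V(·)` denotes the set of extreme points. -/
noncomputable def compPoly (P f : Set E) : Set E :=
  convexHull ℝ (P.extremePoints ℝ \ f.extremePoints ℝ)

/-- The pyramidal width `δ(P) = min over faces f of dist(f, P^f)`. -/
noncomputable def pyramidalWidth (P : Set E) : ℝ :=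
  sInf {d : ℝ | ∃ f : Set E, IsFaceOf P f ∧ d = setDist f (compPoly P f)}

end Defs

section Helpers

open Set Filter

variable {F : Type*} [NormedAddCommGroup F]

theorem setDist_nonneg {X : Type*} [PseudoMetricSpace X] (A B : Set X) : 0 ≤ setDist A B := by
  apply Real.sInf_nonneg
  rintro _ ⟨p, -, rfl⟩
  exact dist_nonneg

theorem setDist_le_dist {X : Type*} [PseudoMetricSpace X] {A B : Set X} {a b : X}
    (ha : a ∈ A) (hb : b ∈ B) : setDist A B ≤ dist a b := by
  apply csInf_le
  · refine ⟨0, ?_⟩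
    rintro _ ⟨p, -, rfl⟩
    exact dist_nonneg
  · exact ⟨(a, b), ⟨ha, hb⟩, rfl⟩

variable [InnerProductSpace ℝ F]

theorem pyramidalWidth_nonneg (P : Set F) : 0 ≤ pyramidalWidth P := by
  apply Real.sInf_nonneg
  rintro _ ⟨f, -, rfl⟩
  exact setDist_nonneg _ _

theorem pyramidalWidth_le_setDist {P f : Set F} (hf : IsFaceOf P f) :
    pyramidalWidth P ≤ setDist f (compPoly P f) := by
  apply csInf_le
  · refine ⟨0, ?_⟩
    rintro _ ⟨f, -, rfl⟩
    exact setDist_nonneg _ _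
  · exact ⟨f, hf, rfl⟩

theorem IsExposed.compPoly_eq {P f : Set F} (hf : IsExposed ℝ P f) :
    compPoly P f = convexHull ℝ (P.extremePoints ℝ \ f) := by
  rw [compPoly, hf.isExtreme.extremePoints_eq]
  congr 1
  ext x
  simp only [Set.mem_sdiff, mem_inter_iff]
  tauto

/-- Finite-dimensional Minkowski theorem for sets with finitely many extreme points. -/
theorem IsCompact.convexHull_extremePoints_eq {P : Set F} (hc : IsCompact P) (hconv : Convex ℝ P)
    (hfin : (P.extremePoints ℝ).Finite) : convexHull ℝ (P.extremePoints ℝ) = P := by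
  rw [← (hfin.isClosed_convexHull ℝ).closure_eq]
  exact closure_convexHull_extremePoints hc hconv

/-- The ray from a relative interior point of a convex set to a point of its affine span outside
the set leaves it through a supporting hyperplane. -/
theorem exists_supporting_of_mem_affineSpan [FiniteDimensional ℝ F] {f : Set F}
    (hcl : IsClosed f) (hconv : Convex ℝ f) (hne : f.Nonempty) {q : F}
    (hq : q ∈ affineSpan ℝ f) (hqf : q ∉ f) :
    ∃ a ∈ f, ∃ y ∈ f, ∃ s : ℝ, 0 ≤ s ∧ q = y + s • (y - a) ∧
      ∃ g : StrongDual ℝ F, (∀ x ∈ f, g x ≤ g y) ∧ g a < g y := by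
  obtain ⟨p, hp⟩ := hne
  set D : Set F := (fun x => x - p) '' f with hD
  set W := Submodule.span ℝ D
  set K : Set W := (↑) ⁻¹' D with hK
  have memK : ∀ w : W, w ∈ K ↔ (w : F) + p ∈ f := by
    intro w
    simp only [hK, hD, mem_preimage, mem_image]
    constructor
    · rintro ⟨x, hx, h⟩
      rw [← h]; simpa using hx
    · intro h
      exact ⟨_, h, by simp⟩
  have hKset : K = (fun w : W => (w : F) + p) ⁻¹' f := by
    ext w; exact memK w
  have hKcl : IsClosed K := by
    rw [hKset]; exact hcl.preimage (by fun_prop)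
  have hKconv : Convex ℝ K := by
    intro u hu v hv α β hα hβ hαβ
    rw [memK] at *
    have := hconv hu hv hα hβ hαβ
    convert this using 1
    have hp' : p = α • p + β • p := by rw [← add_smul, hαβ, one_smul]
    push_cast
    nth_rewrite 1 [hp']
    simp only [smul_add]
    abel
  have h0 : (0 : W) ∈ K := by rw [memK]; simpa using hp
  have hspan : Submodule.span ℝ K = ⊤ := Submodule.span_span_coe_preimage
  have haff : affineSpan ℝ K = ⊤ := by
    rw [AffineSubspace.affineSpan_eq_top_iff_vectorSpan_eq_top_of_nonempty ℝ W W ⟨0, h0⟩,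
      vectorSpan_eq_span_vsub_set_right ℝ h0]
    simpa using hspan
  obtain ⟨a, ha⟩ := hKconv.interior_nonempty_iff_affineSpan_eq_top.2 haff
  have hqW : q - p ∈ W := by
    have := AffineSubspace.vsub_mem_direction hq (subset_affineSpan ℝ f hp)
    rwa [direction_affineSpan, vectorSpan_eq_span_vsub_set_right ℝ hp] at this
  set x : W := ⟨q - p, hqW⟩ with hx
  have hxK : x ∉ K := by rw [memK]; simpa [hx] using hqf
  obtain ⟨y, hyseg, hyK, hyint⟩ : ∃ y ∈ segment ℝ a x, y ∈ K ∧ y ∉ interior K := by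
    by_contra! hcon
    obtain ⟨z, -, hz, hz'⟩ := (convex_segment (𝕜 := ℝ) a x).isPreconnected (interior K) Kᶜ
      isOpen_interior hKcl.isOpen_compl
      (fun z hz => (em (z ∈ K)).imp (hcon z hz) id)
      ⟨a, left_mem_segment ℝ a x, ha⟩ ⟨x, right_mem_segment ℝ a x, hxK⟩
    exact hz' (interior_subset hz)
  obtain ⟨g, hg⟩ := geometric_hahn_banach_open_point hKconv.interior isOpen_interior hyint
  have hgK : ∀ w ∈ K, g w ≤ g y := by
    intro w hw
    have hw' : w ∈ closure (interior K) := by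
      rw [hKconv.closure_interior_eq_closure_of_nonempty_interior ⟨a, ha⟩]
      exact subset_closure hw
    exact closure_minimal (fun z hz => (hg z hz).le)
      (isClosed_le g.continuous continuous_const) hw'
  obtain ⟨G, hG, -⟩ := exists_extension_norm_eq W g
  rw [segment_eq_image'] at hyseg
  obtain ⟨t, ⟨ht0, ht1⟩, hyt⟩ := hyseg
  have htne : t ≠ 0 := by
    rintro rfl
    apply hyint
    rw [← hyt]
    simpa using ha
  refine ⟨a + p, (memK a).1 (interior_subset ha), y + p, (memK y).1 hyK, (1 - t) / t,
    div_nonneg (by linarith) ht0, ?_, G, ?_, ?_⟩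
  · have hyt' : (y : F) = a + t • (q - p - a) := by
      rw [← hyt]; simp [hx]
    have : q = p + a + (q - p - a) := by abel
    rw [hyt']
    have h2 : (1 - t) / t * t = 1 - t := by field_simp
    rw [show ((a : F) + t • (q - p - a) + p - (a + p)) = t • (q - p - a) by abel, smul_smul, h2,
      sub_smul, one_smul]
    abel
  · intro z hz
    have hzK : z - p ∈ W := Submodule.subset_span ⟨z, hz, rfl⟩
    have := hgK ⟨z - p, hzK⟩ ((memK _).2 (by simpa using hz))
    rw [← hG, ← hG] at this
    simp only [map_sub, map_add] at this ⊢
    linarith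
  · have := hg a ha
    rw [← hG, ← hG] at this
    simpa using this

/-- An exposed subset of an exposed subset of a polytope is exposed in the polytope. -/
theorem IsExposed.trans_of_finite_extremePoints {P f : Set F} (hf : IsExposed ℝ P f)
    (hfin : (P.extremePoints ℝ).Finite) (hP : convexHull ℝ (P.extremePoints ℝ) = P)
    {y : F} (hy : y ∈ f) (g : StrongDual ℝ F) (hg : ∀ x ∈ f, g x ≤ g y) :
    IsExposed ℝ P {x ∈ f | g x = g y} := by
  intro _
  obtain ⟨l, rfl⟩ := hf ⟨y, hy⟩
  have key : ∀ᶠ N : ℝ in atTop, ∀ v ∈ P.extremePoints ℝ, N * l v + g v ≤ N * l y + g y := by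
    rw [eventually_all_finite hfin]
    intro v hv
    rcases (hy.2 v hv.1).lt_or_eq with h | h
    · filter_upwards [eventually_ge_atTop ((g v - g y) / (l y - l v))] with N hN
      rw [div_le_iff₀ (by linarith)] at hN
      linarith
    · have hvf : g v ≤ g y := hg v ⟨hv.1, fun z hz => by rw [h]; exact hy.2 z hz⟩
      exact Eventually.of_forall fun N => by rw [h]; linarith
  obtain ⟨N, hN⟩ := eventually_atTop.1 key
  have hN' : ∀ M, N ≤ M → ∀ x ∈ P, M * l x + g x ≤ M * l y + g y := by
    intro M hM x hx
    have hsub : convexHull ℝ (P.extremePoints ℝ) ⊆ {x | (M • l + g) x ≤ (M • l + g) y} := by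
      apply convexHull_min
      · intro v hv
        simpa using hN M hM v hv
      · exact convex_halfSpace_le (M • l + g).isLinear _
    rw [hP] at hsub
    simpa using hsub hx
  refine ⟨(N + 1) • l + g, ?_⟩
  ext x
  simp only [mem_ofPred_eq, add_apply, smul_apply,
    smul_eq_mul]
  constructor
  · rintro ⟨⟨hxP, hxl⟩, hxg⟩
    refine ⟨hxP, fun z hz => ?_⟩
    have h1 : l x = l y := le_antisymm (hy.2 x hxP) (hxl y hy.1)
    rw [h1, hxg]
    exact hN' _ (by linarith) z hz
  · rintro ⟨hxP, hmax⟩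
    have h1 := hN' N le_rfl x hxP
    have h2 := hmax y hy.1
    have h3 := hy.2 x hxP
    have h4 : l x = l y := by linarith
    refine ⟨⟨hxP, fun z hz => by rw [h4]; exact hy.2 z hz⟩, ?_⟩
    rw [h4] at h1 h2
    linarith

/-- The pyramidal width bounds the distance from the affine span of a face to the complementary
polytope, not only the distance from the face itself. -/
theorem pyramidalWidth_le_dist_affineSpan [FiniteDimensional ℝ F] {P : Set F} (hc : IsCompact P)
    (hconv : Convex ℝ P) (hfin : (P.extremePoints ℝ).Finite) :
    ∀ (n : ℕ) (f : Set F), (f.extremePoints ℝ).ncard = n → IsFaceOf P f →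
      ∀ q ∈ affineSpan ℝ f, ∀ b ∈ convexHull ℝ (P.extremePoints ℝ \ f),
        pyramidalWidth P ≤ dist q b := by
  intro n
  induction n using Nat.strong_induction_on with
  | _ n ih =>
  intro f hn hf q hq b hb
  have face_le : ∀ f, IsFaceOf P f → ∀ q ∈ f, ∀ b ∈ convexHull ℝ (P.extremePoints ℝ \ f),
      pyramidalWidth P ≤ dist q b := by
    intro f hf q hq b hb
    rw [← hf.1.compPoly_eq] at hb
    exact (pyramidalWidth_le_setDist hf).trans (setDist_le_dist hq hb)
  by_cases hqf : q ∈ f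
  · exact face_le f hf q hqf b hb
  have hP := hc.convexHull_extremePoints_eq hconv hfin
  have hfc := hf.1.isCompact hc
  have hfconv := hf.1.convex hconv
  obtain ⟨a, ha, y, hy, s, hs, hqe, g, hg, hga⟩ :=
    exists_supporting_of_mem_affineSpan hfc.isClosed hfconv hf.2.1 hq hqf
  set f' : Set F := {x ∈ f | g x = g y}
  have hexp : IsExposed ℝ P f' := hf.1.trans_of_finite_extremePoints hfin hP hy g hg
  have hsub : f' ⊆ f := fun x hx => hx.1
  have hyf' : y ∈ f' := ⟨hy, rfl⟩
  have haf' : a ∉ f' := fun h => hga.ne h.2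
  have hface : IsFaceOf P f' := ⟨hexp, ⟨y, hyf'⟩, fun h => haf' (h ▸ hf.1.subset ha)⟩
  have hextf := hf.1.isExtreme.extremePoints_eq
  have hextf' := hexp.isExtreme.extremePoints_eq
  have hfinf : (f.extremePoints ℝ).Finite := hfin.subset (hextf ▸ inter_subset_right)
  have hfhull := hfc.convexHull_extremePoints_eq hfconv hfinf
  have hf'conv : Convex ℝ f' := hexp.convex hconv
  have hnot : ¬ f.extremePoints ℝ ⊆ f' := fun h =>
    haf' ((convexHull_min h hf'conv) (hfhull.symm ▸ ha))
  have hssub : f'.extremePoints ℝ ⊂ f.extremePoints ℝ := by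
    refine ⟨?_, fun h => hnot (h.trans extremePoints_subset)⟩
    rw [hextf, hextf']
    exact inter_subset_inter_left _ hsub
  have hcard := ncard_lt_ncard hssub hfinf
  have hb' : b ∈ convexHull ℝ (P.extremePoints ℝ \ f') :=
    convexHull_mono (sdiff_subset_sdiff_right hsub) hb
  -- split `a` along the vertices of `f` on and off the supporting hyperplane
  have hsplit : f.extremePoints ℝ = f'.extremePoints ℝ ∪ (f.extremePoints ℝ \ f') := by
    rw [hextf, hextf']
    ext x
    simp only [mem_inter_iff, mem_union, Set.mem_sdiff]
    have := @hsub x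
    tauto
  have hne0 : (f'.extremePoints ℝ).Nonempty :=
    (hexp.isCompact hc).extremePoints_nonempty ⟨y, hyf'⟩
  have hne1 : (f.extremePoints ℝ \ f').Nonempty := by
    obtain ⟨v, hv, hv'⟩ := not_subset.1 hnot
    exact ⟨v, hv, hv'⟩
  have ha' := ha
  rw [← hfhull, hsplit, convexHull_union hne0 hne1, mem_convexJoin] at ha'
  obtain ⟨a0, ha0, a1, ha1, r, m, hr, hm, hrm, hae⟩ := ha'
  have ha0f : a0 ∈ f' := convexHull_min extremePoints_subset hf'conv ha0
  have ha1f : a1 ∈ convexHull ℝ (P.extremePoints ℝ \ f') := by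
    refine convexHull_mono (sdiff_subset_sdiff_left ?_) ha1
    rw [hextf]; exact inter_subset_right
  have hpos : 0 < 1 + s * m := by positivity
  set b' : F := (1 / (1 + s * m)) • b + (s * m / (1 + s * m)) • a1 with hb'd
  have hb'm : b' ∈ convexHull ℝ (P.extremePoints ℝ \ f') := by
    refine convex_convexHull ℝ _ hb' ha1f (by positivity) (by positivity) ?_
    field_simp
  set q' : F := AffineMap.lineMap y a0 (-(s * r / (1 + s * m))) with hq'd
  have hq' : q' ∈ affineSpan ℝ f' :=
    AffineMap.lineMap_mem _ (subset_affineSpan ℝ _ hyf') (subset_affineSpan ℝ _ ha0f)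
  have hmain := ih _ (hn ▸ hcard) f' rfl hface q' hq' b' hb'm
  have hkey : q - b = (1 + s * m) • (q' - b') := by
    have hr' : r = 1 - m := by linarith
    rw [hqe, ← hae, hq'd, hb'd, AffineMap.lineMap_apply_module', hr']
    match_scalars <;> field
  rw [dist_eq_norm] at hmain ⊢
  rw [hkey, norm_smul, Real.norm_of_nonneg hpos.le]
  have : 0 ≤ s * m := by positivity
  nlinarith [norm_nonneg (q' - b')]

theorem IsCompact.compPoly_nonempty {P f : Set F} (hc : IsCompact P) (hconv : Convex ℝ P)
    (hf : IsFaceOf P f) : (compPoly P f).Nonempty := by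
  rw [hf.1.compPoly_eq, convexHull_nonempty_iff]
  by_contra h
  rw [not_nonempty_iff_eq_empty, sdiff_eq_empty] at h
  apply hf.2.2
  apply hf.1.subset.antisymm
  rw [← closure_convexHull_extremePoints hc hconv]
  exact closure_minimal (convexHull_min h (hf.1.convex hconv)) (hf.1.isCompact hc).isClosed

theorem IsCompact.exists_isFaceOf {P : Set F} (hc : IsCompact P) (hn : P.Nontrivial) :
    ∃ f, IsFaceOf P f := by
  obtain ⟨u, hu, v, hv, huv⟩ := hn
  have hlt : inner ℝ (v - u) u < inner ℝ (v - u) v := by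
    have : 0 < inner ℝ (v - u) (v - u) := real_inner_self_pos.2 (sub_ne_zero.2 huv.symm)
    rw [inner_sub_right] at this
    linarith
  obtain ⟨m, hm, hmax⟩ := hc.exists_isMaxOn ⟨u, hu⟩ (innerSL ℝ (v - u)).continuous.continuousOn
  refine ⟨{x ∈ P | ∀ y ∈ P, innerSL ℝ (v - u) y ≤ innerSL ℝ (v - u) x},
    fun _ => ⟨innerSL ℝ (v - u), rfl⟩, ⟨m, hm, fun y hy => hmax hy⟩, fun h => ?_⟩
  have hu' := hu
  rw [← h] at hu'
  exact (hu'.2 v hv).not_gt hlt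

/-- A vector of norm at most one, constant on the exposed set `f`, that separates `f` from
the remaining vertices by the pyramidal width. -/
theorem exists_separating_vector [FiniteDimensional ℝ F] {P f : Set F} (hc : IsCompact P)
    (hconv : Convex ℝ P) (hfin : (P.extremePoints ℝ).Finite) (hf : IsExposed ℝ P f)
    (hne : f.Nonempty) :
    ∃ n : F, ‖n‖ ≤ 1 ∧ (∀ x ∈ f, ∀ v ∈ f, inner ℝ n (v - x) = 0) ∧
      ∀ x ∈ f, ∀ v ∈ P.extremePoints ℝ \ f, pyramidalWidth P ≤ inner ℝ n (v - x) := by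
  rcases (pyramidalWidth_nonneg P).eq_or_lt with h0 | hpos
  · exact ⟨0, by simp, by simp, by simp [← h0]⟩
  by_cases hfP : f = P
  · refine ⟨0, by simp, by simp, fun x _ v hv => ?_⟩
    exact absurd (hfP ▸ hv.1.1) hv.2
  have hface : IsFaceOf P f := ⟨hf, hne, hfP⟩
  obtain ⟨x₀, hx₀⟩ := hne
  set W := vectorSpan ℝ f
  have hWf : ∀ x ∈ f, ∀ v ∈ f, v - x ∈ W := fun x hx v hv => vsub_mem_vectorSpan ℝ hv hx
  set t := convexHull ℝ (P.extremePoints ℝ \ f) with ht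
  have htne : t.Nonempty := by
    rw [ht, ← hf.compPoly_eq]
    exact hc.compPoly_nonempty hconv hface
  set C : Set F := (Wᗮ.starProjection : F →L[ℝ] F) '' ((fun b => b - x₀) '' t)
  have htc : IsCompact t := (hfin.subset sdiff_subset).isCompact_convexHull ℝ
  have hCc : IsCompact C :=
    (htc.image (by fun_prop)).image Wᗮ.starProjection.continuous
  have hCconv : Convex ℝ C := by
    apply Convex.is_linear_image _ Wᗮ.starProjection.isLinear
    simpa [sub_eq_neg_add] using (convex_convexHull ℝ _).translate (-x₀)
  obtain ⟨c, hcC, hcmin⟩ := exists_norm_eq_iInf_of_complete_convex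
    ((htne.image _).image _) hCc.isComplete hCconv 0
  rw [norm_eq_iInf_iff_real_inner_le_zero hCconv hcC] at hcmin
  have hcW : c ∈ Wᗮ := by
    obtain ⟨z, -, rfl⟩ := hcC
    exact Submodule.starProjection_apply_mem _ _
  have hcn : pyramidalWidth P ≤ ‖c‖ := by
    obtain ⟨_, ⟨b, hb, rfl⟩, hbc⟩ := hcC
    have h := pyramidalWidth_le_dist_affineSpan hc hconv hfin _ f rfl hface
      (W.starProjection (b - x₀) +ᵥ x₀)
      ((AffineSubspace.vadd_mem_iff_mem_direction _ (subset_affineSpan ℝ f hx₀)).2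
        (by rw [direction_affineSpan]; exact Submodule.starProjection_apply_mem _ _)) b hb
    rw [dist_comm, dist_eq_norm] at h
    refine h.trans_eq (congrArg norm ?_)
    rw [← hbc, Submodule.starProjection_orthogonal]
    simp only [vadd_eq_add, sub_apply, ContinuousLinearMap.id_apply]
    abel
  have hcpos : 0 < ‖c‖ := hpos.trans_le hcn
  refine ⟨‖c‖⁻¹ • c, ?_, fun x hx v hv => ?_, fun x hx v hv => ?_⟩
  · rw [norm_smul, norm_inv, norm_norm, inv_mul_cancel₀ hcpos.ne']
  · rw [real_inner_smul_left, Submodule.inner_left_of_mem_orthogonal (hWf x hx v hv) hcW, mul_zero]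
  · have h1 := hcmin _ ⟨v - x₀, ⟨v, subset_convexHull ℝ _ hv, rfl⟩, rfl⟩
    rw [inner_sub_right, zero_sub, inner_neg_left, inner_neg_left, real_inner_self_eq_norm_sq,
      ← Submodule.inner_starProjection_left_eq_right,
      Submodule.starProjection_eq_self_iff.2 hcW] at h1
    have h2 : inner ℝ c (x₀ - x) = 0 := Submodule.inner_left_of_mem_orthogonal (hWf x hx x₀ hx₀) hcW
    have h3 : ‖c‖ ^ 2 ≤ inner ℝ c (v - x) := by
      rw [show v - x = (v - x₀) + (x₀ - x) by abel, inner_add_right, h2]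
      linarith
    rw [real_inner_smul_left]
    calc pyramidalWidth P ≤ ‖c‖ := hcn
      _ = ‖c‖⁻¹ * ‖c‖ ^ 2 := by field_simp
      _ ≤ _ := by gcongr

theorem IsPolytope.finite_extremePoints {P : Set F} (hP : IsPolytope P) :
    (P.extremePoints ℝ).Finite := by
  obtain ⟨V, hV, -, rfl⟩ := hP
  exact hV.subset extremePoints_convexHull_subset

theorem IsPolytope.isCompact {P : Set F} (hP : IsPolytope P) : IsCompact P := by
  obtain ⟨V, hV, -, rfl⟩ := hP
  exact hV.isCompact_convexHull ℝ

theorem IsPolytope.convex {P : Set F} (hP : IsPolytope P) : Convex ℝ P := by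
  obtain ⟨V, -, -, rfl⟩ := hP
  exact convex_convexHull ℝ V

section Product

variable {ι : Type*} {G : ι → Type*}

theorem toLp_update_mem_piLp_prod [DecidableEq ι] {P : ∀ i, Set (G i)} {x : PiLp 2 G}
    (hx : ∀ i, x i ∈ P i) (i : ι) {w : G i} (hw : w ∈ P i) (j : ι) :
    (WithLp.toLp 2 (Function.update x.ofLp i w) : PiLp 2 G) j ∈ P j := by
  rcases eq_or_ne j i with rfl | h
  · simpa using hw
  · simpa [h] using hx j

variable [∀ i, NormedAddCommGroup (G i)]

theorem isCompact_piLp_prod {P : ∀ i, Set (G i)} (hP : ∀ i, IsCompact (P i)) :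
    IsCompact {x : PiLp 2 G | ∀ i, x i ∈ P i} := by
  convert (isCompact_univ_pi hP).image (PiLp.continuous_toLp 2 G)
  ext x
  constructor
  · intro hx
    exact ⟨x.ofLp, fun i _ => hx i, rfl⟩
  · rintro ⟨y, hy, rfl⟩ i
    exact hy i trivial

variable [∀ i, InnerProductSpace ℝ (G i)]

theorem convex_piLp_prod {P : ∀ i, Set (G i)} (hP : ∀ i, Convex ℝ (P i)) :
    Convex ℝ {x : PiLp 2 G | ∀ i, x i ∈ P i} := by
  intro x hx y hy a b ha hb hab i
  exact hP i (hx i) (hy i) ha hb hab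

theorem apply_mem_extremePoints_of_mem_extremePoints_piLp_prod {P : ∀ i, Set (G i)} {x : PiLp 2 G}
    (hx : x ∈ {x : PiLp 2 G | ∀ i, x i ∈ P i}.extremePoints ℝ) (i : ι) :
    x i ∈ (P i).extremePoints ℝ := by
  classical
  refine ⟨hx.1 i, fun u hu v hv huv => ?_⟩
  obtain ⟨a, b, ha, hb, hab, h⟩ := huv
  have := hx.2 (toLp_update_mem_piLp_prod hx.1 i hu) (toLp_update_mem_piLp_prod hx.1 i hv)
    ⟨a, b, ha, hb, hab, ?_⟩
  · have := congrArg (fun z : PiLp 2 G => z i) this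
    simpa using this
  · ext j
    rcases eq_or_ne j i with rfl | hj
    · simpa using h
    · simp [hj, ← add_smul, hab]

variable [Fintype ι]

/-- A nonempty exposed subset of a product is a product of exposed subsets. -/
theorem IsExposed.exists_eq_piLp_prod [∀ i, FiniteDimensional ℝ (G i)] {P : ∀ i, Set (G i)}
    {f : Set (PiLp 2 G)} (hf : IsExposed ℝ {x : PiLp 2 G | ∀ i, x i ∈ P i} f) (hne : f.Nonempty) :
    ∃ φ : ∀ i, Set (G i), (∀ i, IsExposed ℝ (P i) (φ i)) ∧ f = {x | ∀ i, x i ∈ φ i} := by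
  classical
  obtain ⟨l, rfl⟩ := hf hne
  obtain ⟨m, hm⟩ := hne
  let L : ∀ i, StrongDual ℝ (G i) := fun i => LinearMap.toContinuousLinearMap
    (l.toLinearMap ∘ₗ (WithLp.linearEquiv 2 ℝ (∀ i, G i)).symm.toLinearMap ∘ₗ
      LinearMap.single ℝ G i)
  have hl : ∀ x, l x = ∑ i, L i (x i) := by
    intro x
    have hx : x = (WithLp.linearEquiv 2 ℝ (∀ i, G i)).symm (∑ i, Pi.single i (x i)) := by
      rw [Finset.univ_sum_single]; rfl
    conv_lhs => rw [hx, map_sum, map_sum]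
    rfl
  refine ⟨fun i => {x ∈ P i | ∀ y ∈ P i, L i y ≤ L i x}, fun i _ => ⟨L i, rfl⟩, ?_⟩
  ext x
  constructor
  · rintro ⟨hx, hmax⟩ i
    refine ⟨hx i, fun y hy => ?_⟩
    have h := hmax _ (toLp_update_mem_piLp_prod hx i hy)
    rw [hl, hl, ← Finset.add_sum_erase _ _ (Finset.mem_univ i),
      ← Finset.add_sum_erase _ (fun j => L j (x j)) (Finset.mem_univ i)] at h
    rw [Finset.sum_congr rfl (g := fun j => L j (x j))] at h
    · simpa only [Function.update_self, add_le_add_iff_right] using h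
    · intro j hj
      simp [Finset.ne_of_mem_erase hj]
  · intro hx
    refine ⟨fun i => (hx i).1, fun y hy => ?_⟩
    rw [hl, hl]
    exact Finset.sum_le_sum fun i _ => (hx i).2 _ (hy i)

/-- The pyramidal width of an `ℓ²` product is at least the smallest pyramidal width of the
factors divided by the square root of the number of factors. -/
theorem le_sqrt_card_mul_pyramidalWidth_piLp_prod [Nonempty ι] [∀ i, FiniteDimensional ℝ (G i)]
    {P : ∀ i, Set (G i)} (hP : ∀ i, IsPolytope (P i)) (hPn : ∀ i, (P i).Nontrivial) {δ : ℝ}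
    (hδ : ∀ i, δ ≤ pyramidalWidth (P i)) :
    δ ≤ √(Fintype.card ι) * pyramidalWidth {x : PiLp 2 G | ∀ i, x i ∈ P i} := by
  have hc := isCompact_piLp_prod fun i => (hP i).isCompact
  have hconv := convex_piLp_prod fun i => (hP i).convex
  have hk : (0 : ℝ) < √(Fintype.card ι) :=
    Real.sqrt_pos.2 (Nat.cast_pos.2 Fintype.card_pos)
  rw [← div_le_iff₀' hk]
  apply le_csInf
  · have hn : {x : PiLp 2 G | ∀ i, x i ∈ P i}.Nontrivial := by
      choose u hu v hv huv using hPn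
      refine ⟨WithLp.toLp 2 u, hu, WithLp.toLp 2 v, hv, fun h => ?_⟩
      exact huv (Classical.arbitrary ι) (congrArg (fun z : PiLp 2 G => z _) h)
    obtain ⟨f, hf⟩ := hc.exists_isFaceOf hn
    exact ⟨_, f, hf, rfl⟩
  rintro _ ⟨f, hf, rfl⟩
  apply le_csInf ((hf.2.1.prod (hc.compPoly_nonempty hconv hf)).image _)
  rintro _ ⟨⟨x, z⟩, ⟨hx, hz⟩, rfl⟩
  rw [hf.1.compPoly_eq] at hz
  obtain ⟨φ, hφ, hfφ⟩ := hf.1.exists_eq_piLp_prod hf.2.1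
  have hxφ : ∀ i, x i ∈ φ i := by rw [hfφ] at hx; exact hx
  choose n hn1 hn0 hnδ using fun i => exists_separating_vector (hP i).isCompact (hP i).convex
    (hP i).finite_extremePoints (hφ i) ⟨x i, hxφ i⟩
  set N : PiLp 2 G := WithLp.toLp 2 n
  have hNn : ‖N‖ ≤ √(Fintype.card ι) := by
    apply Real.le_sqrt_of_sq_le
    rw [PiLp.norm_sq_eq_of_L2]
    calc ∑ i, ‖n i‖ ^ 2 ≤ ∑ _i : ι, (1 : ℝ) :=
          Finset.sum_le_sum fun i _ => pow_le_one₀ (norm_nonneg _) (hn1 i)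
      _ = _ := by simp
  have hvert : {x : PiLp 2 G | ∀ i, x i ∈ P i}.extremePoints ℝ \ f ⊆
      {v | δ + inner ℝ N x ≤ innerSL ℝ N v} := by
    rintro v ⟨hv, hvf⟩
    have hterm : ∀ i, 0 ≤ inner ℝ (n i) (v i - x i) := by
      intro i
      by_cases hvi : v i ∈ φ i
      · exact (hn0 i _ (hxφ i) _ hvi).ge
      · exact (pyramidalWidth_nonneg _).trans (hnδ i _ (hxφ i) _
          ⟨apply_mem_extremePoints_of_mem_extremePoints_piLp_prod hv i, hvi⟩)
    obtain ⟨i, hi⟩ : ∃ i, v i ∉ φ i := by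
      by_contra! h
      exact hvf (hfφ ▸ h)
    have hle : δ ≤ inner ℝ N (v - x) := by
      rw [PiLp.inner_apply]
      calc δ ≤ inner ℝ (n i) (v i - x i) := (hδ i).trans (hnδ i _ (hxφ i) _
            ⟨apply_mem_extremePoints_of_mem_extremePoints_piLp_prod hv i, hi⟩)
        _ ≤ ∑ i, inner ℝ (n i) (v i - x i) :=
          Finset.single_le_sum (fun i _ => hterm i) (Finset.mem_univ i)
    rw [inner_sub_right] at hle
    simp only [mem_ofPred_eq, innerSL_apply_apply]
    linarith
  have hz' := convexHull_min hvert (convex_halfSpace_ge (innerSL ℝ N).isLinear _) hz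
  simp only [mem_ofPred_eq, innerSL_apply_apply] at hz'
  rw [div_le_iff₀' hk]
  change δ ≤ _ * dist x z
  rw [dist_comm, dist_eq_norm]
  calc δ ≤ inner ℝ N (z - x) := by rw [inner_sub_right]; linarith
    _ ≤ ‖N‖ * ‖z - x‖ := real_inner_le_norm _ _
    _ ≤ _ := by gcongr

end Product

end Helpers

/-- Lower bound for the pyramidal width of a `k`-fold product (`k ≥ 2`) of polytopes with
at least two vertices, with the ℓ² product norm:
`δ(P) ≥ (1/√2)^⌈log₂(k+1)⌉ · minᵢ δ(Pᵢ)`. -/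
theorem pyramidalWidth_pi_prod_ge
    (k : ℕ) (hk : 2 ≤ k) (E : Fin k → Type*)
    [∀ i, NormedAddCommGroup (E i)] [∀ i, InnerProductSpace ℝ (E i)]
    [∀ i, FiniteDimensional ℝ (E i)]
    (P : ∀ i, Set (E i)) (hP : ∀ i, IsPolytope (P i))
    (hPv : ∀ i, ((P i).extremePoints ℝ).Nontrivial) :
    pyramidalWidth {x : PiLp 2 E | ∀ i, x i ∈ P i} ≥
      (1 / Real.sqrt 2) ^ (Nat.clog 2 (k + 1)) * ⨅ i, pyramidalWidth (P i) := by
  have hk0 : Nonempty (Fin k) := ⟨⟨0, by omega⟩⟩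
  set δ : ℝ := ⨅ i, pyramidalWidth (P i)
  have hδ0 : 0 ≤ δ := Real.iInf_nonneg fun i => pyramidalWidth_nonneg _
  have hmain := le_sqrt_card_mul_pyramidalWidth_piLp_prod hP
    (fun i => (hPv i).mono extremePoints_subset)
    (fun i => (ciInf_le (Set.finite_range _).bddBelow i : δ ≤ pyramidalWidth (P i)))
  rw [Fintype.card_fin] at hmain
  have hpw := pyramidalWidth_nonneg {x : PiLp 2 E | ∀ i, x i ∈ P i}
  have hpow : √(k : ℝ) ≤ √2 ^ Nat.clog 2 (k + 1) := by
    apply Real.sqrt_le_iff.2 ⟨by positivity, ?_⟩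
    rw [← pow_mul, mul_comm, pow_mul, Real.sq_sqrt (by norm_num)]
    exact_mod_cast (Nat.le_succ k).trans (Nat.le_pow_clog one_lt_two (k + 1))
  rw [ge_iff_le, div_pow, one_pow, one_div_mul_eq_div, div_le_iff₀' (by positivity)]
  exact hmain.trans (by gcongr)
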